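/- arXiv:1910.04258 — 3 statements merged into one kernel-verified Lean document; each statement's English description precedes it below -/
import Mathlib

section
/- For all n ≥ 1, the negative Eulerian polynomial A_n^-(t) = ∑_{w ∈ S_n, sgn(w)=-1} t^{des(w)+1} satisfies A_n^-(t)/(1-t)^{n+1} = ∑_{k ≥ 0} ((k^n - k^{⌈n/2⌉})/2) t^k as formal power series. -/
open scoped Classical

/-- Number of descents of a permutation of `{0,…,n-1}`. -/
noncomputable def desA {n : ℕ} (w : Equiv.Perm (Fin n)) : ℕ :=
  ((Finset.range (n - 1)).filter (fun i =>
    ∃ h : i + 1 < n, w ⟨i + 1, h⟩ < w ⟨i, Nat.lt_of_succ_lt h⟩)).card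

/-- Number of inversions of a permutation. -/
noncomputable def invA {n : ℕ} (w : Equiv.Perm (Fin n)) : ℕ :=
  (Finset.univ.filter (fun p : Fin n × Fin n => p.1 < p.2 ∧ w p.2 < w p.1)).card

/-- Number of ascents of a permutation of `{0,…,m}` at positions smaller than `i`. -/
noncomputable def ascBefore {m : ℕ} (w : Equiv.Perm (Fin (m + 1))) (i : ℕ) : ℕ :=
  ((Finset.range i).filter (fun i => ¬ ∃ h : i + 1 < m + 1,
    w ⟨i + 1, h⟩ < w ⟨i, Nat.lt_of_succ_lt h⟩)).card

lemma ascBefore_succ {m : ℕ} (w : Equiv.Perm (Fin (m + 1))) (i : Fin m) :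
    ascBefore w (i + 1) = ascBefore w i + if w i.castSucc < w i.succ then 1 else 0 := by
  have hne : w i.castSucc ≠ w i.succ := fun h => by
    have := w.injective h
    simp [Fin.ext_iff] at this
  have hP : (¬ ∃ h : (i : ℕ) + 1 < m + 1, w ⟨i + 1, h⟩ < w ⟨i, Nat.lt_of_succ_lt h⟩) ↔
      w i.castSucc < w i.succ := by
    have : (∃ h : (i : ℕ) + 1 < m + 1, w ⟨i + 1, h⟩ < w ⟨i, Nat.lt_of_succ_lt h⟩) ↔
      w i.succ < w i.castSucc := ⟨fun ⟨_, h⟩ => h, fun h => ⟨by omega, h⟩⟩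
    rw [this]
    exact not_lt.trans ⟨fun h => lt_of_le_of_ne h hne, le_of_lt⟩
  unfold ascBefore
  rw [Finset.range_add_one, Finset.filter_insert]
  by_cases h : w i.castSucc < w i.succ
  · rw [if_pos (hP.2 h), if_pos h, Finset.card_insert_of_notMem (by simp)]
  · rw [if_neg (mt hP.1 h), if_neg h]; rfl

lemma desA_add_ascBefore {m : ℕ} (w : Equiv.Perm (Fin (m + 1))) :
    desA w + ascBefore w m = m := by
  unfold desA ascBefore
  rw [Nat.add_sub_cancel, Finset.card_filter_add_card_filter_not, Finset.card_range]

lemma strictMono_toLex_sort {n k : ℕ} (f : Fin n → Fin k) :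
    StrictMono (fun i => toLex (f (Tuple.sort f i), Tuple.sort f i)) :=
  Tuple.eq_sort_iff'.1 rfl

lemma sort_eq_iff_strictMono {m k : ℕ} (w : Equiv.Perm (Fin (m + 1))) (f : Fin (m + 1) → Fin k) :
    Tuple.sort f = w ↔
      StrictMono (fun i : Fin (m + 1) => (f (w i) : ℕ) + ascBefore w i) := by
  have key : w = Tuple.sort f ↔ StrictMono (fun i => toLex (f (w i), w i)) :=
    Tuple.eq_sort_iff'
  rw [eq_comm, key, Fin.strictMono_iff_lt_succ, Fin.strictMono_iff_lt_succ]
  refine forall_congr' fun i => ?_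
  rw [Prod.Lex.toLex_lt_toLex, Fin.val_succ, Fin.val_castSucc, ascBefore_succ, Fin.lt_def,
    Fin.ext_iff]
  dsimp only
  split_ifs with h
  · simp only [h, and_true]; omega
  · simp only [h, and_false, or_false]; omega

lemma val_le_of_strictMono {m : ℕ} {h : Fin (m + 1) → ℕ} (hh : StrictMono h) (i : Fin (m + 1)) :
    (i : ℕ) ≤ h i := by
  induction i using Fin.induction with
  | zero => simp
  | succ i ih =>
    have := hh (Fin.castSucc_lt_succ (i := i))
    simp only [Fin.val_succ, Fin.val_castSucc] at *
    omega

lemma add_sub_le_last_of_strictMono {m : ℕ} {h : Fin (m + 1) → ℕ} (hh : StrictMono h)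
    (i : Fin (m + 1)) : h i + (m - i) ≤ h (Fin.last m) := by
  induction i using Fin.reverseInduction with
  | last => simp
  | cast i ih =>
    have := hh (Fin.castSucc_lt_succ (i := i))
    have := i.2
    simp only [Fin.val_succ, Fin.val_castSucc] at *
    omega

lemma ascBefore_le {m : ℕ} (w : Equiv.Perm (Fin (m + 1))) (i : ℕ) : ascBefore w i ≤ i :=
  (Finset.card_filter_le _ _).trans (Finset.card_range i).le

lemma ascBefore_le_add {m : ℕ} (w : Equiv.Perm (Fin (m + 1))) (i : Fin (m + 1)) :
    ascBefore w m ≤ ascBefore w i + (m - i) := by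
  induction i using Fin.reverseInduction with
  | last => simp
  | cast i ih =>
    have h1 := ascBefore_succ w i
    have h2 : (if w i.castSucc < w i.succ then 1 else 0) ≤ 1 := by split_ifs <;> simp
    have := i.2
    simp only [Fin.val_succ, Fin.val_castSucc] at *
    omega

/-- Tuples with a prescribed stable sorting permutation correspond to increasing sequences. -/
noncomputable def sortFiberEquiv {m : ℕ} (w : Equiv.Perm (Fin (m + 1))) (k : ℕ) :
    {f : Fin (m + 1) → Fin k // Tuple.sort f = w} ≃
      (Fin (m + 1) ↪o Fin (k + ascBefore w m)) where
  toFun f := OrderEmbedding.ofStrictMono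
    (fun i => ⟨f.1 (w i) + ascBefore w i, by
      have h := (sort_eq_iff_strictMono w f.1).1 f.2
      have h1 := h.monotone (Fin.le_last i)
      have h2 := (f.1 (w (Fin.last m))).2
      simp only [Fin.val_last] at h1
      omega⟩)
    (fun i j hij => (sort_eq_iff_strictMono w f.1).1 f.2 hij)
  invFun h := ⟨fun x => ⟨h (w.symm x) - ascBefore w (w.symm x), by
      have hs : StrictMono (fun i => (h i : ℕ)) := fun i j hij => h.strictMono hij
      have h1 := add_sub_le_last_of_strictMono hs (w.symm x)
      have h2 := ascBefore_le_add w (w.symm x)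
      have h3 := val_le_of_strictMono hs (w.symm x)
      have h4 := ascBefore_le w (w.symm x)
      have h5 := (h (Fin.last m)).2
      have h6 := ascBefore_le w m
      have h7 := val_le_of_strictMono hs (Fin.last m)
      simp only [Fin.val_last] at h7
      omega⟩, by
      rw [sort_eq_iff_strictMono]
      have hs : StrictMono (fun i => (h i : ℕ)) := fun i j hij => h.strictMono hij
      convert hs using 2 with i
      have h3 := val_le_of_strictMono hs i
      have h4 := ascBefore_le w i
      simp only [Equiv.symm_apply_apply]
      omega⟩
  left_inv f := by
    ext x
    simp [OrderEmbedding.ofStrictMono]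
  right_inv h := by
    have hs : StrictMono (fun i => (h i : ℕ)) := fun i j hij => h.strictMono hij
    ext i
    have h3 := val_le_of_strictMono hs i
    have h4 := ascBefore_le w i
    simp
    omega

lemma card_sort_eq {m : ℕ} (w : Equiv.Perm (Fin (m + 1))) (k : ℕ) :
    (Finset.univ.filter (fun f : Fin (m + 1) → Fin k => Tuple.sort f = w)).card =
      (k + ascBefore w m).choose (m + 1) := by
  rw [← Fintype.card_subtype, ← Nat.card_eq_fintype_card,
    Nat.card_congr ((sortFiberEquiv w k).trans Set.powersetCard.ofFinEmbEquiv),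
    Set.powersetCard.card, Nat.card_fin]

lemma sum_weight_X_pow_desA {m : ℕ} (χ : Equiv.Perm (Fin (m + 1)) → ℚ) :
    ∑ w, PowerSeries.C (χ w) * (PowerSeries.X : PowerSeries ℚ) ^ (desA w + 1) =
      (1 - PowerSeries.X) ^ (m + 2) *
        PowerSeries.mk (fun k => ∑ f : Fin (m + 1) → Fin k, χ (Tuple.sort f)) := by
  have hinv : (1 - PowerSeries.X) ^ (m + 2) *
      PowerSeries.mk (fun j => ((m + 1 + j).choose (m + 1) : ℚ)) = 1 :=
    (PowerSeries.invOneSubPow ℚ (m + 2)).inv_val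
  have hmk : PowerSeries.mk (fun k => ∑ f : Fin (m + 1) → Fin k, χ (Tuple.sort f)) =
      (∑ w, PowerSeries.C (χ w) * (PowerSeries.X : PowerSeries ℚ) ^ (desA w + 1)) *
        PowerSeries.mk (fun j => ((m + 1 + j).choose (m + 1) : ℚ)) := by
    ext k
    rw [PowerSeries.coeff_mk, Finset.sum_mul, map_sum,
      ← Finset.sum_fiberwise (s := Finset.univ) (g := fun f : Fin (m + 1) → Fin k => Tuple.sort f)]
    refine Finset.sum_congr rfl fun w _ => ?_
    rw [Finset.sum_congr rfl (g := fun _ => χ w) (fun f hf => by rw [(Finset.mem_filter.1 hf).2]),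
      Finset.sum_const, card_sort_eq, mul_assoc, PowerSeries.coeff_C_mul,
      PowerSeries.coeff_X_pow_mul', nsmul_eq_mul, mul_comm]
    have h := desA_add_ascBefore w
    congr 1
    split_ifs with hk
    · rw [PowerSeries.coeff_mk]
      congr 2
      omega
    · rw [Nat.choose_eq_zero_of_lt (by omega), Nat.cast_zero]
  rw [hmk, mul_left_comm, hinv, mul_one]

/-- The sign `(-1)^inv` of a word, where `inv` counts its inversions. -/
def wordSign {n k : ℕ} (f : Fin n → Fin k) : ℚ :=
  ∏ i, ∏ j, if i < j ∧ f j < f i then -1 else 1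

lemma sign_sort {n k : ℕ} (f : Fin n → Fin k) :
    ((Equiv.Perm.sign (Tuple.sort f) : ℤ) : ℚ) = wordSign f := by
  rw [← Equiv.Perm.sign_inv, Equiv.Perm.sign_eq_prod_prod_Ioi, wordSign]
  push_cast
  refine Finset.prod_congr rfl fun i _ => ?_
  rw [← Finset.filter_lt_eq_Ioi, Finset.prod_filter]
  refine Finset.prod_congr rfl fun j _ => ?_
  have h : (Tuple.sort f)⁻¹ i < (Tuple.sort f)⁻¹ j ↔ toLex (f i, i) < toLex (f j, j) := by
    rw [← (strictMono_toLex_sort f).lt_iff_lt]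
    simp
  by_cases hij : i < j
  · have h' : (f i < f j ∨ f i = f j) ↔ ¬ f j < f i := by rw [not_lt, le_iff_lt_or_eq]
    simp only [h, Prod.Lex.toLex_lt_toLex, hij, and_true, true_and, if_true, h']
    split_ifs <;> simp_all
  · simp [hij]

lemma wordSign_cons {n k : ℕ} (a : Fin k) (f : Fin n → Fin k) :
    wordSign (Fin.cons a f : Fin (n + 1) → Fin k) =
      (∏ j, if f j < a then -1 else 1) * wordSign f := by
  simp [wordSign, Fin.prod_univ_succ]

lemma sum_fin_succ_pi {n k : ℕ} (F : (Fin (n + 1) → Fin k) → ℚ) :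
    ∑ f, F f = ∑ a, ∑ f : Fin n → Fin k, F (Fin.cons a f) := by
  rw [← Fintype.sum_prod_type' (f := fun a (f : Fin n → Fin k) => F (Fin.cons a f))]
  exact (Fintype.sum_equiv (Fin.consEquiv fun _ => Fin k) _ _ fun _ => rfl).symm

lemma sum_sum_inversion_sign {k : ℕ} (u : Fin k → ℚ) (hu : ∀ a, u a * u a = 1) :
    ∑ a, ∑ b, (if b < a then -1 else 1) * (u a * u b) = (k : ℚ) := by
  have h : ∑ a, ∑ b, ((if b < a then -1 else 1) * (u a * u b) +
      (if a < b then -1 else 1) * (u b * u a)) = 2 * (k : ℚ) := by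
    have (a b : Fin k) : (if b < a then -1 else 1) * (u a * u b) +
        (if a < b then -1 else 1) * (u b * u a) = if a = b then (2 : ℚ) else 0 := by
      rcases lt_trichotomy a b with hab | rfl | hab
      · simp [hab, hab.not_gt, hab.ne, mul_comm]
      · simp [hu]; norm_num
      · simp [hab, hab.not_gt, hab.ne', mul_comm]
    simp_rw [this]
    simp [mul_comm]
  simp_rw [Finset.sum_add_distrib] at h
  rw [Finset.sum_comm (f := fun a b => (if a < b then -1 else 1) * (u b * u a))] at h
  linarith

lemma sum_wordSign_add_two (n k : ℕ) :
    ∑ f : Fin (n + 2) → Fin k, wordSign f = k * ∑ f : Fin n → Fin k, wordSign f := by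
  simp_rw [sum_fin_succ_pi, wordSign_cons, Fin.prod_univ_succ, Fin.cons_zero, Fin.cons_succ]
  simp_rw [Finset.sum_comm (s := (Finset.univ : Finset (Fin k)))
    (t := (Finset.univ : Finset (Fin n → Fin k))), Finset.mul_sum]
  refine Finset.sum_congr rfl fun f _ => ?_
  rw [← sum_sum_inversion_sign (fun a => ∏ j, if f j < a then -1 else 1), Finset.sum_mul]
  · refine Finset.sum_congr rfl fun a _ => ?_
    rw [Finset.sum_mul]
    exact Finset.sum_congr rfl fun b _ => by ring
  · intro a
    rw [← Finset.prod_mul_distrib]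
    exact Finset.prod_eq_one fun j _ => by split_ifs <;> norm_num

lemma sum_wordSign (n k : ℕ) :
    ∑ f : Fin n → Fin k, wordSign f = (k : ℚ) ^ ((n + 1) / 2) := by
  induction n using Nat.twoStepInduction with
  | zero => simp [wordSign]
  | one => simp [wordSign]
  | more n ih _ =>
    rw [sum_wordSign_add_two, ih, ← pow_succ', show n + 2 + 1 = n + 1 + 2 by ring,
      Nat.add_div_right _ two_pos]

theorem negative_eulerian_series (n : ℕ) (hn : 1 ≤ n) :
    ∑ w ∈ Finset.univ.filter (fun w : Equiv.Perm (Fin n) => Equiv.Perm.sign w = -1),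
        (PowerSeries.X : PowerSeries ℚ) ^ (desA w + 1)
      = (1 - PowerSeries.X) ^ (n + 1) *
          PowerSeries.mk (fun k => ((k : ℚ) ^ n - (k : ℚ) ^ ((n + 1) / 2)) / 2) := by
  obtain ⟨m, rfl⟩ := Nat.exists_eq_add_of_le' hn
  have h := sum_weight_X_pow_desA
    (fun w : Equiv.Perm (Fin (m + 1)) => if Equiv.Perm.sign w = -1 then 1 else 0)
  have hχ (w : Equiv.Perm (Fin (m + 1))) :
      (if Equiv.Perm.sign w = -1 then 1 else 0 : ℚ) = (1 - ((Equiv.Perm.sign w : ℤ) : ℚ)) / 2 := by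
    rcases Int.units_eq_one_or (Equiv.Perm.sign w) with hw | hw <;> simp [hw]
  have hsum (k : ℕ) : ∑ f : Fin (m + 1) → Fin k,
      (if Equiv.Perm.sign (Tuple.sort f) = -1 then 1 else 0 : ℚ) =
        ((k : ℚ) ^ (m + 1) - (k : ℚ) ^ ((m + 1 + 1) / 2)) / 2 := by
    simp_rw [hχ, sign_sort]
    rw [← Finset.sum_div, Finset.sum_sub_distrib, sum_wordSign]
    simp
  simp_rw [hsum] at h
  rw [← h, Finset.sum_filter]
  refine Finset.sum_congr rfl fun w _ => ?_
  split_ifs <;> simp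
end

section
/- For all n ≥ 1: A_{2n}(-1,t) = (1-t)^n A_n(t) and A_{2n+1}(-1,t) = (1-t)^n A_{n+1}(t), where A_n(q,t) = ∑_{w ∈ S_n} q^{inv(w)} t^{des(w)+1} and A_n(t) = A_n(1,t). -/
open scoped Classical

/-- Number of descents of the word `y :: l`. -/
def wordDes : ℕ → List ℕ → ℕ
  | _, [] => 0
  | y, z :: l => (if z < y then 1 else 0) + wordDes z l

/-- Number of inversions of the word `l`. -/
def wordInv : List ℕ → ℕ
  | [] => 0
  | z :: l => l.countP (· < z) + wordInv l

open Polynomial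

/-- The monomial `q ^ inv l * X ^ des (y :: l)`. -/
noncomputable def wordWeight (q : ℤ[X]) (y : ℕ) (l : List ℕ) : ℤ[X] :=
  q ^ wordInv l * X ^ wordDes y l

/-- Total weight of the words obtained by inserting the letter `a` into `l`. -/
noncomputable def insertSum (q : ℤ[X]) (a y : ℕ) (l : List ℕ) : ℤ[X] :=
  ((List.permutations'Aux a l).map (wordWeight q y)).sum

lemma wordWeight_cons (q : ℤ[X]) (y z : ℕ) (l : List ℕ) :
    wordWeight q y (z :: l) =
      q ^ l.countP (· < z) * (X ^ (if z < y then 1 else 0) * wordWeight q z l) := by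
  simp only [wordWeight, wordInv, wordDes]
  ring

lemma countP_lt_eq_length {b : ℕ} {l : List ℕ} (hl : ∀ x ∈ l, x < b) :
    l.countP (· < b) = l.length := by
  simpa using hl

lemma perm_cons_of_mem_permutations'Aux {a : ℕ} {l l' : List ℕ}
    (h : l' ∈ List.permutations'Aux a l) : l'.Perm (a :: l) := by
  induction l generalizing l' with
  | nil => simp_all
  | cons z l ih =>
    simp only [List.permutations'Aux, List.mem_cons, List.mem_map] at h
    rcases h with rfl | ⟨l'', h, rfl⟩
    · rfl
    · exact ((ih h).cons z).trans (List.Perm.swap _ _ _)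

lemma countP_lt_of_mem_permutations'Aux {a z : ℕ} {l l' : List ℕ} (hz : z < a)
    (h : l' ∈ List.permutations'Aux a l) : l'.countP (· < z) = l.countP (· < z) := by
  rw [(perm_cons_of_mem_permutations'Aux h).countP_eq, List.countP_cons_of_neg]
  simpa using hz.le

lemma insertSum_nil (q : ℤ[X]) {b y : ℕ} (hy : y ≤ b) : insertSum q b y [] = 1 := by
  simp [insertSum, wordWeight, wordInv, wordDes, hy.not_gt]

lemma insertSum_cons (q : ℤ[X]) {b y z : ℕ} {l : List ℕ} (hy : y ≤ b) (hz : z < b)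
    (hl : ∀ x ∈ l, x < b) :
    insertSum q b y (z :: l) = q ^ l.countP (· < z) *
      (q ^ (l.length + 1) * X * wordWeight q z l +
        X ^ (if z < y then 1 else 0) * insertSum q b z l) := by
  have h1 : wordWeight q y (b :: z :: l) =
      q ^ l.countP (· < z) * (q ^ (l.length + 1) * X * wordWeight q z l) := by
    have : (z :: l).countP (· < b) = l.length + 1 :=
      countP_lt_eq_length (by simpa [hz] using hl)
    rw [wordWeight_cons, wordWeight_cons, this]
    simp only [hy.not_gt, hz, if_true, if_false]
    ring
  have h2 : ((List.permutations'Aux b l).map (fun l' => wordWeight q y (z :: l'))).sum =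
      q ^ l.countP (· < z) * (X ^ (if z < y then 1 else 0) * insertSum q b z l) := by
    rw [insertSum, ← List.sum_map_mul_left, ← List.sum_map_mul_left]
    congr 1
    refine List.map_congr_left fun l' h => ?_
    rw [wordWeight_cons, countP_lt_of_mem_permutations'Aux hz h]
  rw [mul_add, ← h1, ← h2]
  simp [insertSum, Function.comp_def]

lemma insertSum_congr (q : ℤ[X]) {a b y : ℕ} {l : List ℕ} (hya : y ≤ a) (hyb : y ≤ b)
    (ha : ∀ x ∈ l, x < a) (hb : ∀ x ∈ l, x < b) : insertSum q a y l = insertSum q b y l := by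
  induction l generalizing y with
  | nil => rw [insertSum_nil q hya, insertSum_nil q hyb]
  | cons z l ih =>
    simp only [List.mem_cons, forall_eq_or_imp] at ha hb
    rw [insertSum_cons q hya ha.1 ha.2, insertSum_cons q hyb hb.1 hb.2,
      ih ha.1.le hb.1.le ha.2 hb.2]

/-- The total weight of the insertions of a new maximum in a word of length `k`
with `d` descents. -/
noncomputable def insertPoly (k d : ℕ) : ℤ[X] :=
  (d + 1) * (X : ℤ[X]) ^ d + (k - d) * (X : ℤ[X]) ^ (d + 1)

lemma insertPoly_succ (k d e : ℕ) (he : e = 0 ∨ e = 1) :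
    insertPoly (k + 1) (e + d) = X ^ (d + 1) + X ^ e * insertPoly k d := by
  rcases he with rfl | rfl <;> simp only [insertPoly] <;> push_cast <;> ring

lemma insertSum_one {b y : ℕ} {l : List ℕ} (hy : y ≤ b) (hl : ∀ x ∈ l, x < b) :
    insertSum 1 b y l = insertPoly l.length (wordDes y l) := by
  induction l generalizing y with
  | nil => simp [insertSum_nil 1 hy, insertPoly, wordDes]
  | cons z l ih =>
    simp only [List.mem_cons, forall_eq_or_imp] at hl
    rw [insertSum_cons 1 hy hl.1 hl.2, ih hl.1.le hl.2, List.length_cons, wordDes,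
      insertPoly_succ _ _ _ (by split_ifs <;> simp), wordWeight]
    ring

/-- Non-adjacent insertions of two consecutive maxima cancel in the signed sum. -/
lemma sum_insertSum_neg_one {a b y : ℕ} {l : List ℕ} (hy : y ≤ a) (hab : a < b)
    (hl : ∀ x ∈ l, x < a) :
    ((List.permutations'Aux a l).map (insertSum (-1) b y)).sum =
      (1 - X) * ((-1) ^ wordInv l * insertPoly l.length (wordDes y l)) := by
  induction l generalizing y with
  | nil =>
    have hyb := hy.trans hab.le
    simp [insertSum, insertPoly, wordWeight, wordDes, wordInv, hab, hy.not_gt, hyb.not_gt,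
      hab.not_gt]
    ring
  | cons z l ih =>
    simp only [List.mem_cons, forall_eq_or_imp] at hl
    obtain ⟨hz, hl⟩ := hl
    have hlb : ∀ x ∈ l, x < b := fun x hx => (hl x hx).trans hab
    have hzb := hz.trans hab
    have htail : ((List.permutations'Aux a l).map (fun l' => insertSum (-1) b y (z :: l'))).sum =
        (-1) ^ l.countP (· < z) * ((-1) ^ (l.length + 2) * X * insertSum (-1) a z l +
          X ^ (if z < y then 1 else 0) *
            ((List.permutations'Aux a l).map (insertSum (-1) b z)).sum) := by
      rw [insertSum, ← List.sum_map_mul_left, ← List.sum_map_mul_left, ← List.sum_map_add,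
        ← List.sum_map_mul_left]
      congr 1
      refine List.map_congr_left fun l' h => ?_
      have hp := perm_cons_of_mem_permutations'Aux h
      rw [insertSum_cons _ (hy.trans hab.le) hzb, countP_lt_of_mem_permutations'Aux hz h,
        hp.length_eq, List.length_cons]
      intro x hx
      rcases List.mem_cons.1 (hp.mem_iff.1 hx) with rfl | hx
      exacts [hab, hlb x hx]
    have hhead : insertSum (-1) b y (a :: z :: l) = (-1) ^ l.countP (· < z) *
        ((X - X ^ 2) * wordWeight (-1) z l + (-1) ^ (l.length + 1) * X * insertSum (-1) b z l) := by
      have hc : (z :: l).countP (· < a) = l.length + 1 :=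
        countP_lt_eq_length (by simpa [hz] using hl)
      rw [insertSum_cons _ (hy.trans hab.le) hab (by simpa [hzb] using hlb),
        insertSum_cons _ hab.le hzb hlb, wordWeight_cons, hc, List.length_cons]
      simp only [hy.not_gt, hz, if_true, if_false]
      rcases neg_one_pow_eq_or ℤ[X] l.length with h | h <;> simp only [pow_succ, h] <;> ring
    have hsplit : ((List.permutations'Aux a (z :: l)).map (insertSum (-1) b y)).sum =
        insertSum (-1) b y (a :: z :: l) +
          ((List.permutations'Aux a l).map (fun l' => insertSum (-1) b y (z :: l'))).sum := by
      simp [Function.comp_def]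
    rw [hsplit, hhead, htail, ih hz.le hl, insertSum_congr _ hz.le hzb.le hl hlb,
      List.length_cons, wordDes, insertPoly_succ _ _ _ (by split_ifs <;> simp), wordInv, wordWeight]
    ring

lemma X_mul_insertPoly (k d : ℕ) :
    X * insertPoly k d =
      X * (1 - X) * derivative (X ^ (d + 1) : ℤ[X]) + ((k : ℤ[X]) + 1) * X * X ^ (d + 1) := by
  rw [insertPoly, derivative_X_pow]
  simp
  ring

/-- The `q`-Eulerian polynomial as a sum over words. -/
noncomputable def wordEulerian (q : ℤ[X]) (n : ℕ) : ℤ[X] :=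
  ((List.range n).reverse.permutations'.map (fun l => X * wordWeight q 0 l)).sum

/-- The operator taking the `n`-th Eulerian polynomial to the next one. -/
noncomputable def eulerStep (n : ℕ) (f : ℤ[X]) : ℤ[X] :=
  X * (1 - X) * derivative f + ((n : ℤ[X]) + 1) * X * f

lemma eulerStep_wordEulerian {q : ℤ[X]} (hq : q = 1 ∨ q = -1) (n : ℕ) :
    eulerStep n (wordEulerian q n) =
      ((List.range n).reverse.permutations'.map
        (fun l => X * (q ^ wordInv l * insertPoly l.length (wordDes 0 l)))).sum := by
  rw [eulerStep, wordEulerian, map_list_sum, List.map_map, ← List.sum_map_mul_left,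
    ← List.sum_map_mul_left, ← List.sum_map_add]
  congr 1
  refine List.map_congr_left fun l h => ?_
  have hlen : l.length = n := by
    simpa using (List.mem_permutations'.1 h).length_eq
  have hd : derivative (q ^ wordInv l * X ^ (wordDes 0 l + 1)) =
      q ^ wordInv l * derivative (X ^ (wordDes 0 l + 1) : ℤ[X]) := by
    rcases hq with rfl | rfl
    · simp
    · rcases neg_one_pow_eq_or ℤ[X] (wordInv l) with h | h <;> simp [h]
  have hw : X * wordWeight q 0 l = q ^ wordInv l * X ^ (wordDes 0 l + 1) := by
    rw [wordWeight]; ring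
  rw [Function.comp_apply, hw, hd, hlen, mul_left_comm X (q ^ _), X_mul_insertPoly]
  ring

lemma lt_of_mem_permutations'_range {n x : ℕ} {l : List ℕ}
    (h : l ∈ (List.range n).reverse.permutations') (hx : x ∈ l) : x < n := by
  simpa using (List.mem_permutations'.1 h).mem_iff.1 hx

lemma wordEulerian_succ (q : ℤ[X]) (n : ℕ) :
    wordEulerian q (n + 1) = ((List.range n).reverse.permutations'.map
      (fun l => X * insertSum q n 0 l)).sum := by
  simp [wordEulerian, List.range_succ, List.permutations', List.flatMap, List.map_flatten,
    List.sum_flatten, Function.comp_def, insertSum, List.sum_map_mul_left]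

lemma wordEulerian_one_succ (n : ℕ) :
    wordEulerian 1 (n + 1) = eulerStep n (wordEulerian 1 n) := by
  rw [wordEulerian_succ, eulerStep_wordEulerian (.inl rfl)]
  congr 1
  refine List.map_congr_left fun l h => ?_
  rw [insertSum_one n.zero_le fun x => lt_of_mem_permutations'_range h]
  simp

lemma wordEulerian_neg_one_add_two (n : ℕ) :
    wordEulerian (-1) (n + 2) = (1 - X) * eulerStep n (wordEulerian (-1) n) := by
  have h2 : wordEulerian (-1) (n + 2) = ((List.range n).reverse.permutations'.map
      (fun l => X * ((List.permutations'Aux n l).map (insertSum (-1) (n + 1) 0)).sum)).sum := by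
    rw [wordEulerian_succ]
    simp [List.range_succ, List.permutations', List.flatMap, List.map_flatten,
      List.sum_flatten, Function.comp_def, List.sum_map_mul_left]
  rw [h2, eulerStep_wordEulerian (.inr rfl), ← List.sum_map_mul_left]
  congr 1
  refine List.map_congr_left fun l h => ?_
  rw [sum_insertSum_neg_one n.zero_le n.lt_succ_self fun x => lt_of_mem_permutations'_range h]
  ring

lemma eulerStep_one_sub_X_pow_mul (m n : ℕ) (f : ℤ[X]) :
    eulerStep (m + n) ((1 - X) ^ n * f) = (1 - X) ^ n * eulerStep m f := by
  have hd : (1 - X) * derivative ((1 - X : ℤ[X]) ^ n) = -(n : ℤ[X]) * (1 - X) ^ n := by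
    cases n with
    | zero => simp
    | succ n => simp [derivative_pow]; ring
  simp only [eulerStep, derivative_mul]
  push_cast
  linear_combination X * f * hd

lemma wordEulerian_neg_one_even (n : ℕ) :
    wordEulerian (-1) (2 * n) = (1 - X) ^ n * wordEulerian 1 n := by
  induction n with
  | zero => simp [wordEulerian, wordWeight, wordInv]
  | succ n ih =>
    rw [mul_add_one, wordEulerian_neg_one_add_two, ih, two_mul, eulerStep_one_sub_X_pow_mul,
      wordEulerian_one_succ]
    ring

lemma wordEulerian_neg_one_odd (n : ℕ) :
    wordEulerian (-1) (2 * n + 1) = (1 - X) ^ n * wordEulerian 1 (n + 1) := by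
  induction n with
  | zero => simp [wordEulerian, wordWeight, wordInv]
  | succ n ih =>
    rw [show 2 * (n + 1) + 1 = 2 * n + 1 + 2 by ring, wordEulerian_neg_one_add_two, ih,
      show 2 * n + 1 = n + 1 + n by ring, eulerStep_one_sub_X_pow_mul,
      wordEulerian_one_succ (n + 1)]
    ring

lemma countP_ofFn {n : ℕ} (c : ℕ) (f : Fin n → ℕ) :
    (List.ofFn f).countP (· < c) = ∑ i, if f i < c then 1 else 0 := by
  induction n with
  | zero => simp
  | succ n ih =>
    rw [List.ofFn_succ, List.countP_cons, ih, Fin.sum_univ_succ, add_comm]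
    simp

lemma wordInv_ofFn {n : ℕ} (f : Fin n → ℕ) :
    wordInv (List.ofFn f) =
      (Finset.univ.filter (fun p : Fin n × Fin n => p.1 < p.2 ∧ f p.2 < f p.1)).card := by
  rw [Finset.card_filter, Fintype.sum_prod_type]
  induction n with
  | zero => simp [wordInv]
  | succ n ih => simp [wordInv, ih, countP_ofFn, Fin.sum_univ_succ, -Finset.sum_boole]

lemma wordDes_ofFn {n : ℕ} (y : ℕ) (f : Fin (n + 1) → ℕ) :
    wordDes y (List.ofFn f) = (if f 0 < y then 1 else 0) +
      ∑ i : Fin n, if f i.succ < f i.castSucc then 1 else 0 := by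
  induction n generalizing y with
  | zero => simp [wordDes]
  | succ n ih =>
    rw [List.ofFn_succ, wordDes, ih, Fin.sum_univ_succ (n := n)]
    rfl

lemma desA_eq_wordDes {n : ℕ} (w : Equiv.Perm (Fin n)) :
    desA w = wordDes 0 (List.ofFn fun i => (w i : ℕ)) := by
  cases n with
  | zero => simp [desA, wordDes]
  | succ n =>
    rw [wordDes_ofFn, desA, Finset.card_filter, Finset.sum_range]
    simp
    rfl

lemma mem_permutations'_range_iff {n : ℕ} {l : List ℕ} :
    l ∈ (List.range n).reverse.permutations' ↔
      ∃ w : Equiv.Perm (Fin n), List.ofFn (fun i => (w i : ℕ)) = l := by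
  rw [List.mem_permutations']
  constructor
  · intro h
    have hp := h.trans (List.reverse_perm _)
    have hlen : l.length = n := by simpa using hp.length_eq
    subst hlen
    have hlt (i : Fin l.length) : l[i] < l.length := by
      simpa using hp.mem_iff.1 (List.getElem_mem i.2)
    have hinj : Function.Injective (fun i : Fin l.length => (⟨l[i], hlt i⟩ : Fin l.length)) := by
      intro i j hij
      have := (hp.nodup_iff.2 List.nodup_range).getElem_inj_iff.1 (Fin.mk.inj hij)
      exact Fin.ext this
    exact ⟨Equiv.ofBijective _ (Finite.injective_iff_bijective.1 hinj), by simp⟩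
  · rintro ⟨w, rfl⟩
    have hinj : Function.Injective fun i => (w i : ℕ) := Fin.val_injective.comp w.injective
    rw [List.perm_ext_iff_of_nodup (List.nodup_ofFn.2 hinj)
      (List.nodup_reverse.2 List.nodup_range)]
    intro x
    simp only [List.mem_ofFn, List.mem_reverse, List.mem_range]
    exact ⟨fun ⟨i, hi⟩ => hi ▸ (w i).2, fun hx => ⟨w.symm ⟨x, hx⟩, by simp⟩⟩

lemma sum_perm_eq_wordEulerian (q : ℤ[X]) (n : ℕ) :
    ∑ w : Equiv.Perm (Fin n), q ^ invA w * X ^ (desA w + 1) = wordEulerian q n := by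
  have hnodup : (List.range n).reverse.permutations'.Nodup :=
    (List.permutations_perm_permutations' _).nodup_iff.1
      (List.nodup_permutations _ (List.nodup_reverse.2 List.nodup_range))
  rw [wordEulerian, ← List.sum_toFinset _ hnodup]
  refine Finset.sum_bij (fun w _ => List.ofFn fun i => (w i : ℕ)) ?_ ?_ ?_ ?_
  · intro w _
    exact List.mem_toFinset.2 (mem_permutations'_range_iff.2 ⟨w, rfl⟩)
  · intro w _ w' _ h
    exact Equiv.ext fun i => Fin.ext (congrFun (List.ofFn_injective h) i)
  · intro l hl
    obtain ⟨w, hw⟩ := mem_permutations'_range_iff.1 (List.mem_toFinset.1 hl)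
    exact ⟨w, Finset.mem_univ w, hw⟩
  · intro w _
    have hinv : invA w = wordInv (List.ofFn fun i => (w i : ℕ)) := by
      simp [wordInv_ofFn, invA]
    rw [wordWeight, hinv, desA_eq_wordDes]
    ring

theorem signed_eulerian_desarmenien_foata (n : ℕ) (hn : 1 ≤ n) :
    (∑ w : Equiv.Perm (Fin (2 * n)),
        ((-1 : ℤ) ^ invA w) • (Polynomial.X : Polynomial ℤ) ^ (desA w + 1)
      = (1 - Polynomial.X) ^ n *
          ∑ w : Equiv.Perm (Fin n), (Polynomial.X : Polynomial ℤ) ^ (desA w + 1)) ∧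
    (∑ w : Equiv.Perm (Fin (2 * n + 1)),
        ((-1 : ℤ) ^ invA w) • (Polynomial.X : Polynomial ℤ) ^ (desA w + 1)
      = (1 - Polynomial.X) ^ n *
          ∑ w : Equiv.Perm (Fin (n + 1)), (Polynomial.X : Polynomial ℤ) ^ (desA w + 1)) := by
  have hsigned (m : ℕ) : ∑ w : Equiv.Perm (Fin m),
      ((-1 : ℤ) ^ invA w) • (X : ℤ[X]) ^ (desA w + 1) = wordEulerian (-1) m := by
    simp [← sum_perm_eq_wordEulerian, zsmul_eq_mul]
  have hunsigned (m : ℕ) : ∑ w : Equiv.Perm (Fin m), (X : ℤ[X]) ^ (desA w + 1) =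
      wordEulerian 1 m := by
    simp [← sum_perm_eq_wordEulerian]
  rw [hsigned, hsigned, hunsigned, hunsigned]
  exact ⟨wordEulerian_neg_one_even n, wordEulerian_neg_one_odd n⟩
end

section
/- For all n ≥ 1, B_n^-(t)/(1-t)^{n+1} = ∑_{k ≥ 0} (((2k+1)^n - 1)/2) t^k, where B_n^-(t) = ∑_{w ∈ B_n, sgn_B(w)=-1} t^{des_B(w)}. -/
open scoped Classical

/-- An element of the hyperoctahedral group `B_n`, encoded as an underlying
permutation `u ∈ S_n` together with the set of negated positions (`true` = negated). -/
abbrev BPerm (n : ℕ) := Equiv.Perm (Fin n) × (Fin n → Bool)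

/-- The one-line value `w(i)` (as an integer, positions and values `1,…,n`)
of the signed permutation, with the convention `w(0) = 0`. -/
noncomputable def bval {n : ℕ} (p : BPerm n) (i : ℕ) : ℤ :=
  if h : 1 ≤ i ∧ i ≤ n then
    (if p.2 ⟨i - 1, by omega⟩ then -(((p.1 ⟨i - 1, by omega⟩ : Fin n) : ℕ) + 1 : ℤ)
      else (((p.1 ⟨i - 1, by omega⟩ : Fin n) : ℕ) + 1 : ℤ))
  else 0

/-- The number of type B descents: `0 ≤ i ≤ n-1` with `w(i) > w(i+1)`, where `w(0)=0`. -/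
noncomputable def desB {n : ℕ} (p : BPerm n) : ℕ :=
  ((Finset.range n).filter (fun i => bval p (i + 1) < bval p i)).card

/-- The sign character of `B_n`: `sgn_B(u^J) = (-1)^{|J|} sgn(u)`. -/
noncomputable def sgnB {n : ℕ} (p : BPerm n) : ℤ :=
  (Equiv.Perm.sign p.1 : ℤ) * (-1) ^ ((Finset.univ.filter (fun i => p.2 i = true)).card)

open Finset PowerSeries

section GapSequences

/-- The one-line values of `a`, indexed from `1` to `n`, with value `0` elsewhere. -/
def padZero {n : ℕ} (a : Fin n → ℕ) (i : ℕ) : ℕ :=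
  if h : 1 ≤ i ∧ i ≤ n then a ⟨i - 1, by omega⟩ else 0

@[simp] lemma padZero_zero {n : ℕ} (a : Fin n → ℕ) : padZero a 0 = 0 := by simp [padZero]

@[simp] lemma padZero_succ {n : ℕ} (a : Fin n → ℕ) (i : Fin n) :
    padZero a (i + 1) = a i := by
  have := i.isLt
  simp [padZero]

lemma padZero_snoc_of_le {n : ℕ} (a : Fin n → ℕ) (j : ℕ) {i : ℕ} (hi : i ≤ n) :
    padZero (Fin.snoc a j : Fin (n + 1) → ℕ) i = padZero a i := by
  rcases i with _ | i
  · simp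
  · have h1 := padZero_succ (Fin.snoc a j : Fin (n + 1) → ℕ) (Fin.castSucc ⟨i, hi⟩)
    have h2 := padZero_succ a ⟨i, hi⟩
    rw [Fin.snoc_castSucc] at h1
    exact h1.trans h2.symm

lemma padZero_last {n : ℕ} (a : Fin (n + 1) → ℕ) : padZero a (n + 1) = a (Fin.last n) :=
  padZero_succ a (Fin.last n)

/-- The sequences `0 = a₀, a₁, …, aₙ ≤ k` whose `i`-th step is at least `d i`. -/
noncomputable def gapSeqs (d : ℕ → ℕ) (n k : ℕ) : Finset (Fin n → ℕ) :=
  (Fintype.piFinset fun _ => range (k + 1)).filter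
    fun a => ∀ i < n, padZero a i + d i ≤ padZero a (i + 1)

lemma padZero_mono {d : ℕ → ℕ} {n : ℕ} {a : Fin n → ℕ}
    (h : ∀ i < n, padZero a i + d i ≤ padZero a (i + 1)) {i j : ℕ} (hij : i ≤ j) (hj : j ≤ n) :
    padZero a i ≤ padZero a j := by
  induction j, hij using Nat.le_induction with
  | base => rfl
  | succ j _ ih => exact (ih (by omega)).trans ((Nat.le_add_right _ _).trans (h j (by omega)))

lemma mem_gapSeqs {d : ℕ → ℕ} {n k : ℕ} {a : Fin n → ℕ} :
    a ∈ gapSeqs d n k ↔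
      (∀ i < n, padZero a i + d i ≤ padZero a (i + 1)) ∧ padZero a n ≤ k := by
  simp only [gapSeqs, mem_filter, Fintype.mem_piFinset, mem_range, Nat.lt_succ_iff]
  rw [and_comm]
  refine and_congr_right fun h => ⟨fun ha => ?_, fun ha i => ?_⟩
  · rcases n with _ | n
    · simp
    · rw [padZero_last]; exact ha _
  · rw [← padZero_succ a i]
    exact (padZero_mono h (by omega) le_rfl).trans ha

lemma card_gapSeqs_last_eq (d : ℕ → ℕ) (n k : ℕ) :
    #{a ∈ gapSeqs d (n + 1) k | a (Fin.last n) = k} =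
      if d n ≤ k then #(gapSeqs d n (k - d n)) else 0 := by
  split_ifs with hd
  · refine card_nbij' (fun a => Fin.init a) (fun a => Fin.snoc a k) ?_ ?_ ?_ ?_
    · intro a ha
      simp only [coe_filter, Set.mem_ofPred_eq, mem_gapSeqs] at ha
      simp only [mem_coe, mem_gapSeqs]
      obtain ⟨⟨h, _⟩, hk⟩ := ha
      have hs : (Fin.snoc (Fin.init a) k : Fin (n + 1) → ℕ) = a := by
        rw [← hk, Fin.snoc_init_self]
      have hp : ∀ i ≤ n, padZero (Fin.init a) i = padZero a i := fun i hi => by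
        rw [← padZero_snoc_of_le (Fin.init a) k hi, hs]
      refine ⟨fun i hi => ?_, ?_⟩
      · rw [hp i hi.le, hp (i + 1) hi]
        exact h i (by omega)
      · have := h n (by omega)
        rw [padZero_last, hk] at this
        rw [hp n le_rfl]
        omega
    · intro a ha
      simp only [mem_coe, mem_gapSeqs] at ha
      simp only [coe_filter, Set.mem_ofPred_eq, mem_gapSeqs, padZero_last, Fin.snoc_last, le_refl,
        and_true]
      intro i hi
      rcases Nat.lt_succ_iff_lt_or_eq.mp hi with hi | rfl
      · rw [padZero_snoc_of_le a k hi.le, padZero_snoc_of_le a k hi]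
        exact ha.1 i hi
      · rw [padZero_last, padZero_snoc_of_le a k le_rfl, Fin.snoc_last]
        have := ha.2
        omega
    · intro a ha
      simp only [coe_filter, Set.mem_ofPred_eq] at ha
      simp only [← ha.2, Fin.snoc_init_self]
    · intro a _
      simp
  · rw [card_eq_zero, filter_eq_empty_iff]
    intro a ha hk
    have := (mem_gapSeqs.mp ha).1 n (by omega)
    rw [padZero_last, hk] at this
    omega

lemma card_gapSeqs_succ_succ (d : ℕ → ℕ) (n k : ℕ) :
    #(gapSeqs d (n + 1) (k + 1)) = #(gapSeqs d (n + 1) k) +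
      if d n ≤ k + 1 then #(gapSeqs d n (k + 1 - d n)) else 0 := by
  rw [← card_gapSeqs_last_eq, ← card_filter_add_card_filter_not (fun a => a (Fin.last n) = k + 1),
    add_comm]
  congr 2
  ext a
  simp only [mem_filter, mem_gapSeqs, padZero_last, and_assoc]
  exact and_congr_right fun _ => by omega

lemma card_gapSeqs_succ_zero (d : ℕ → ℕ) (n : ℕ) :
    #(gapSeqs d (n + 1) 0) = if d n ≤ 0 then #(gapSeqs d n (0 - d n)) else 0 := by
  rw [← card_gapSeqs_last_eq]
  congr 1
  ext a
  simp only [mem_filter, mem_gapSeqs, padZero_last, and_assoc]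
  exact and_congr_right fun _ => by omega

lemma one_sub_X_mul_mk_gapSeqs (d : ℕ → ℕ) (n : ℕ) :
    (1 - X : PowerSeries ℚ) * PowerSeries.mk (fun k => (#(gapSeqs d (n + 1) k) : ℚ)) =
      X ^ d n * PowerSeries.mk (fun k => (#(gapSeqs d n k) : ℚ)) := by
  ext k
  rw [sub_mul, one_mul, map_sub, coeff_X_pow_mul']
  rcases k with _ | k
  · rw [coeff_zero_X_mul, coeff_mk, card_gapSeqs_succ_zero]
    simp
  · rw [coeff_succ_X_mul, coeff_mk, coeff_mk, card_gapSeqs_succ_succ]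
    simp

lemma one_sub_X_mul_mk_one : (1 - X : PowerSeries ℚ) * PowerSeries.mk (fun _ => 1) = 1 := by
  rw [mul_comm]
  exact PowerSeries.mk_one_mul_one_sub_eq_one ℚ

lemma one_sub_X_pow_mul_mk_gapSeqs (d : ℕ → ℕ) (n : ℕ) :
    (1 - X : PowerSeries ℚ) ^ (n + 1) * PowerSeries.mk (fun k => (#(gapSeqs d n k) : ℚ)) =
      X ^ ∑ i ∈ range n, d i := by
  induction n with
  | zero => simpa [gapSeqs] using one_sub_X_mul_mk_one
  | succ n ih =>
    rw [pow_succ, mul_assoc, one_sub_X_mul_mk_gapSeqs, mul_left_comm, ih, sum_range_succ, pow_add,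
      mul_comm]

end GapSequences

section SignedPermutations

variable {n : ℕ}

@[simp] lemma bval_zero (p : BPerm n) : bval p 0 = 0 := by simp [bval]

lemma bval_succ (p : BPerm n) (i : Fin n) :
    bval p (i + 1) = if p.2 i then -((p.1 i : ℕ) + 1 : ℤ) else ((p.1 i : ℕ) + 1 : ℤ) := by
  have := i.isLt
  simp [bval]

/-- The indicator of the type B descent set. -/
noncomputable def descentGap (p : BPerm n) (i : ℕ) : ℕ :=
  if bval p (i + 1) < bval p i then 1 else 0

lemma sum_descentGap (p : BPerm n) : ∑ i ∈ range n, descentGap p i = desB p := by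
  simp [descentGap, desB]

/-- The key by which the positions of `f` are sorted: absolute value first, then the signed
letter that the sign of `f` attaches to the position. -/
noncomputable def signedKey (f : Fin n → ℤ) (v : Fin n) : ℕ ×ₗ ℤ :=
  toLex ((f v).natAbs, if f v < 0 then -((v : ℕ) + 1 : ℤ) else ((v : ℕ) + 1 : ℤ))

lemma signedKey_lt_iff (f : Fin n → ℤ) (v w : Fin n) :
    signedKey f v < signedKey f w ↔ (f v).natAbs < (f w).natAbs ∨ (f v).natAbs = (f w).natAbs ∧
      (if f v < 0 then -((v : ℕ) + 1 : ℤ) else ((v : ℕ) + 1 : ℤ)) <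
        if f w < 0 then -((w : ℕ) + 1 : ℤ) else ((w : ℕ) + 1 : ℤ) := by
  simp [signedKey, Prod.Lex.toLex_lt_toLex]

lemma signedKey_injective (f : Fin n → ℤ) : Function.Injective (signedKey f) := by
  intro v w h
  have h2 := congrArg (fun x => (ofLex x).2) h
  simp only [signedKey, ofLex_toLex] at h2
  ext
  split_ifs at h2 <;> omega

/-- The signed permutation sorting `f`. -/
noncomputable def sortingBPerm (f : Fin n → ℤ) : BPerm n :=
  (Tuple.sort (signedKey f), fun i => decide (f (Tuple.sort (signedKey f) i) < 0))

lemma sortingBPerm_eq_iff (f : Fin n → ℤ) (p : BPerm n) :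
    sortingBPerm f = p ↔
      (∀ i, p.2 i = true ↔ f (p.1 i) < 0) ∧ StrictMono (signedKey f ∘ p.1) := by
  constructor
  · rintro rfl
    refine ⟨fun i => by simp [sortingBPerm], ?_⟩
    exact (Tuple.monotone_sort _).strictMono_of_injective
      ((signedKey_injective f).comp (Equiv.injective _))
  · rintro ⟨h1, h2⟩
    have hs : Tuple.sort (signedKey f) = p.1 := by
      have := Tuple.unique_monotone (Tuple.monotone_sort (signedKey f)) h2.monotone
      exact Equiv.ext fun i => signedKey_injective f (congrFun this i)
    refine Prod.ext hs (funext fun i => ?_)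
    simp only [sortingBPerm, hs]
    rw [Bool.eq_iff_iff, h1 i, decide_eq_true_iff]

lemma strictMono_fin_iff {α : Type*} [Preorder α] (g : Fin n → α) :
    StrictMono g ↔ ∀ (i : ℕ) (h : i + 1 < n), g ⟨i, by omega⟩ < g ⟨i + 1, h⟩ := by
  rcases n with _ | n
  · exact ⟨fun _ i h => by omega, fun _ i => i.elim0⟩
  · rw [Fin.strictMono_iff_lt_succ]
    exact ⟨fun h i hi => h ⟨i, by omega⟩, fun h i => h i (by omega)⟩

lemma bval_pos_of_padZero_eq_zero {p : BPerm n} {a : Fin n → ℕ}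
    (h : ∀ i < n, padZero a i + descentGap p i ≤ padZero a (i + 1)) {i : ℕ} (hi : i ≤ n)
    (ha : padZero a i = 0) : 0 ≤ bval p i := by
  induction i with
  | zero => simp
  | succ i ih =>
    have h1 := h i hi
    have h2 := ih (by omega) (by omega)
    by_contra hlt
    rw [descentGap, if_pos (by omega)] at h1
    omega

/-- The function with absolute values `a` along `p` and signs given by `p`. -/
def signedFun (p : BPerm n) (a : Fin n → ℕ) (v : Fin n) : ℤ :=
  if p.2 (p.1.symm v) then -(a (p.1.symm v) : ℤ) else a (p.1.symm v)

lemma signedFun_apply (p : BPerm n) (a : Fin n → ℕ) (i : Fin n) :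
    signedFun p a (p.1 i) = if p.2 i then -(a i : ℤ) else a i := by
  simp [signedFun]

lemma natAbs_signedFun_apply (p : BPerm n) (a : Fin n → ℕ) (i : Fin n) :
    (signedFun p a (p.1 i)).natAbs = a i := by
  rw [signedFun_apply]; split_ifs <;> simp

lemma sorting_natAbs_iff {p : BPerm n} {f : Fin n → ℤ} :
    ((∀ i, p.2 i = true ↔ f (p.1 i) < 0) ∧ StrictMono (signedKey f ∘ p.1)) ↔
      (∀ i, p.2 i = true ↔ f (p.1 i) < 0) ∧
        ∀ i < n, padZero (fun i => (f (p.1 i)).natAbs) i + descentGap p i ≤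
          padZero (fun i => (f (p.1 i)).natAbs) (i + 1) := by
  refine and_congr_right fun hs => ?_
  have key : ∀ i : Fin n, (if f (p.1 i) < 0 then -((p.1 i : ℕ) + 1 : ℤ)
      else ((p.1 i : ℕ) + 1 : ℤ)) = bval p (i + 1) := fun i => by
    rw [bval_succ]; simp only [hs i]
  have ne : ∀ i j : Fin n, i ≠ j → bval p (i + 1) ≠ bval p (j + 1) := fun i j hij h => by
    have : (p.1 i : ℕ) ≠ p.1 j := fun h => hij (p.1.injective (Fin.ext h))
    rw [bval_succ, bval_succ] at h
    split_ifs at h <;> omega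
  rw [strictMono_fin_iff]
  simp only [Function.comp_apply, signedKey_lt_iff, key]
  constructor
  · intro h i hi
    rcases i with _ | i
    · have h1 := padZero_succ (fun i => (f (p.1 i)).natAbs) ⟨0, hi⟩
      have h2 := bval_succ p ⟨0, hi⟩
      have h3 := hs ⟨0, hi⟩
      simp only [zero_add, padZero_zero, descentGap, bval_zero] at h1 h2 ⊢
      split_ifs at h2 ⊢ <;> simp_all <;> omega
    · have h1 := padZero_succ (fun i => (f (p.1 i)).natAbs) ⟨i, by omega⟩
      have h2 := padZero_succ (fun i => (f (p.1 i)).natAbs) ⟨i + 1, hi⟩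
      have h3 := h i hi
      simp only at h1 h2 h3
      rw [h1, h2, descentGap]
      split_ifs <;> omega
  · intro h i hi
    have h1 := padZero_succ (fun i => (f (p.1 i)).natAbs) ⟨i, by omega⟩
    have h2 := padZero_succ (fun i => (f (p.1 i)).natAbs) ⟨i + 1, hi⟩
    have h3 := h (i + 1) hi
    have h4 := ne ⟨i, by omega⟩ ⟨i + 1, hi⟩ (by simp)
    simp only at h1 h2 h3 h4
    rw [h1, h2, descentGap] at h3
    split_ifs at h3 <;> omega

lemma card_sortingBPerm_fiber (p : BPerm n) (k : ℕ) :
    #{f ∈ Fintype.piFinset (fun _ : Fin n => Icc (-(k : ℤ)) k) | sortingBPerm f = p} =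
      #(gapSeqs (descentGap p) n k) := by
  refine card_nbij' (fun f i => (f (p.1 i)).natAbs) (signedFun p) ?_ ?_ ?_ ?_
  · intro f hf
    simp only [coe_filter, Set.mem_ofPred_eq, Fintype.mem_piFinset, mem_Icc, sortingBPerm_eq_iff,
      sorting_natAbs_iff] at hf
    simp only [gapSeqs, mem_coe, mem_filter, Fintype.mem_piFinset, mem_range]
    refine ⟨fun i => ?_, hf.2.2⟩
    have := hf.1 (p.1 i)
    omega
  · intro a ha
    simp only [gapSeqs, mem_coe, mem_filter, Fintype.mem_piFinset, mem_range] at ha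
    simp only [coe_filter, Set.mem_ofPred_eq, Fintype.mem_piFinset, mem_Icc, sortingBPerm_eq_iff,
      sorting_natAbs_iff, natAbs_signedFun_apply]
    refine ⟨fun v => ?_, fun i => ?_, ha.2⟩
    · have := ha.1 (p.1.symm v)
      rw [signedFun]
      split_ifs <;> omega
    · have h1 := bval_pos_of_padZero_eq_zero ha.2 (i := i + 1) (by omega)
      rw [padZero_succ, bval_succ] at h1
      rw [signedFun_apply]
      split_ifs at h1 ⊢ with hJ <;> simp [hJ] <;> omega
  · intro f hf
    simp only [coe_filter, Set.mem_ofPred_eq, sortingBPerm_eq_iff] at hf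
    funext v
    obtain ⟨i, rfl⟩ := p.1.surjective v
    have := hf.2.1 i
    rw [signedFun_apply]
    beta_reduce
    split_ifs with hJ <;> simp only [hJ] at this <;> simp at this <;> omega
  · intro a _
    exact funext fun i => natAbs_signedFun_apply p a i

lemma sum_card_gapSeqs_descentGap (n k : ℕ) :
    ∑ p : BPerm n, #(gapSeqs (descentGap p) n k) = (2 * k + 1) ^ n := by
  simp_rw [← card_sortingBPerm_fiber]
  rw [← card_eq_sum_card_fiberwise (fun _ _ => mem_coe.2 (mem_univ _)), Fintype.card_piFinset_const,
    Int.card_Icc]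
  congr 1
  omega

/-- The type B Eulerian polynomial, as a power series. -/
lemma sum_X_pow_desB (n : ℕ) :
    ∑ p : BPerm n, (X : PowerSeries ℚ) ^ desB p =
      (1 - X) ^ (n + 1) * PowerSeries.mk (fun k => (2 * (k : ℚ) + 1) ^ n) := by
  simp_rw [← sum_descentGap, ← one_sub_X_pow_mul_mk_gapSeqs, ← mul_sum]
  congr 1
  ext k
  rw [map_sum]
  simp only [coeff_mk]
  exact_mod_cast sum_card_gapSeqs_descentGap n k

/-- Negating a letter that is smaller in absolute value than its neighbours preserves descents. -/
lemma desB_update_not (u : Equiv.Perm (Fin n)) (J : Fin n → Bool) (m : Fin n) (hm : (m : ℕ) ≠ 0)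
    (hlt : ∀ i : Fin n, (i : ℕ) + 1 = m ∨ (i : ℕ) = m + 1 → u m < u i) :
    desB (u, Function.update J m (!J m)) = desB (u, J) := by
  have hval : ∀ i : Fin n, i ≠ m →
      bval (u, Function.update J m (!J m)) (i + 1) = bval (u, J) (i + 1) := fun i hi => by
    simp [bval_succ, hi]
  have hneg : bval (u, Function.update J m (!J m)) (m + 1) = -bval (u, J) (m + 1) := by
    cases h : J m <;> simp [bval_succ, h]
  have habs : ∀ i : Fin n, |bval (u, J) (i + 1)| = u i + 1 := fun i => by
    rw [bval_succ]
    split_ifs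
    · rw [abs_neg, abs_of_nonneg (by positivity)]
    · rw [abs_of_nonneg (by positivity)]
  have hm_abs := habs m
  unfold desB
  congr 1
  refine filter_congr fun i hi => ?_
  rw [mem_range] at hi
  rcases i with _ | i
  · have h0 := hval ⟨0, hi⟩ (fun h => hm (by rw [← h]))
    simp only at h0
    rw [h0, bval_zero, bval_zero]
  · have hi' : i < n := by omega
    by_cases h1 : i = m
    · have h2 := hval ⟨i + 1, hi⟩ (fun h => by rw [← h] at h1; simp at h1)
      have h3 := hlt ⟨i + 1, hi⟩ (Or.inr (by simp [h1]))
      have h4 := habs ⟨i + 1, hi⟩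
      simp only [Fin.lt_def] at h2 h3 h4
      subst h1
      rw [h2, hneg]
      grind
    · have h2 := hval ⟨i, hi'⟩ (fun h => h1 (by rw [← h]))
      simp only at h2
      rw [h2]
      by_cases h5 : i + 1 = m
      · have h3 := hlt ⟨i, hi'⟩ (Or.inl h5)
        have h4 := habs ⟨i, hi'⟩
        simp only [Fin.lt_def] at h3 h4
        rw [h5, hneg]
        rw [h5] at h4
        grind
      · have h6 := hval ⟨i + 1, hi⟩ (fun h => h5 (by rw [← h]))
        simp only at h6
        rw [h6]

lemma exists_local_min_of_ne_one {u : Equiv.Perm (Fin n)} (hu : u ≠ 1) :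
    ∃ m : Fin n, (m : ℕ) ≠ 0 ∧
      ∀ i : Fin n, (i : ℕ) + 1 = m ∨ (i : ℕ) = m + 1 → u m < u i := by
  have hex : ∃ j, u j ≠ j := by
    by_contra! h
    exact hu (Equiv.ext h)
  obtain ⟨j, hj, hmin⟩ := WellFounded.has_min (wellFounded_lt (α := Fin n)) {j | u j ≠ j} hex
  have hfix : ∀ i, i < j → u i = i := fun i hi => by
    by_contra h
    exact hmin i h hi
  have hge : ∀ i, j ≤ i → j ≤ u i := fun i hi => by
    by_contra! h
    have := u.injective (hfix _ h)
    omega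
  obtain ⟨m, hm⟩ := u.surjective j
  have hjm : j < m := by
    rcases lt_trichotomy j m with h | h | h
    · exact h
    · exact absurd (h ▸ hm) hj
    · have := hfix m h
      omega
  refine ⟨m, by omega, fun i hi => ?_⟩
  have h1 := hge i (by omega)
  have h2 : u i ≠ u m := fun h => by
    have := u.injective h
    omega
  omega

lemma neg_one_pow_card_update_not (J : Fin n → Bool) (m : Fin n) :
    (-1 : PowerSeries ℚ) ^ #{i | Function.update J m (!J m) i = true} =
      -(-1) ^ #{i | J i = true} := by
  have key : ∀ K : Fin n → Bool, (-1 : PowerSeries ℚ) ^ #{i | K i = true} =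
      ∏ i, if K i = true then -1 else 1 := fun K => by
    rw [prod_ite, prod_const, prod_const_one, mul_one]
  rw [key, key, ← mul_prod_erase univ _ (mem_univ m), ← mul_prod_erase univ _ (mem_univ m)]
  rw [prod_congr rfl fun i hi => by rw [Function.update_of_ne (ne_of_mem_erase hi)]]
  cases J m <;> simp

lemma sum_neg_one_pow_mul_X_pow_desB_of_ne_one {u : Equiv.Perm (Fin n)} (hu : u ≠ 1) :
    ∑ J : Fin n → Bool, (-1 : PowerSeries ℚ) ^ #{i | J i = true} * X ^ desB (u, J) = 0 := by
  obtain ⟨m, hm, hlt⟩ := exists_local_min_of_ne_one hu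
  refine sum_involution (fun J _ => Function.update J m (!J m)) ?_ ?_ ?_ ?_
  · intro J _
    rw [neg_one_pow_card_update_not, desB_update_not u J m hm hlt]
    ring
  · intro J _ _ h
    have := congrFun h m
    simp at this
  · simp
  · intro J _
    simp

lemma desB_one (J : Fin n → Bool) : desB ((1, J) : BPerm n) = #{i | J i = true} := by
  rw [desB, card_filter, card_filter, sum_range]
  refine sum_congr rfl fun i _ => ?_
  congr 1
  rw [bval_succ]
  obtain ⟨i, hi⟩ := i
  rcases i with _ | i
  · cases h : J ⟨0, hi⟩ <;> simp [h]
  · have h2 := bval_succ ((1, J) : BPerm n) ⟨i, by omega⟩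
    simp only [Equiv.Perm.coe_one, id_eq] at h2 ⊢
    rw [h2, eq_iff_iff]
    split_ifs <;> simp_all <;> omega

lemma sum_neg_one_pow_mul_X_pow_desB_one :
    ∑ J : Fin n → Bool, (-1 : PowerSeries ℚ) ^ #{i | J i = true} * X ^ desB ((1, J) : BPerm n) =
      (1 - X) ^ n := by
  have key : ∀ J : Fin n → Bool,
      (-1 : PowerSeries ℚ) ^ #{i | J i = true} * X ^ desB ((1, J) : BPerm n) =
        ∏ i, if J i = true then -X else 1 := fun J => by
    rw [prod_ite, prod_const, prod_const_one, mul_one, desB_one, ← mul_pow, neg_one_mul]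
  simp_rw [key]
  rw [← Fintype.piFinset_univ,
    ← prod_univ_sum (fun _ : Fin n => (univ : Finset Bool))
      (fun _ b => if b = true then (-X : PowerSeries ℚ) else 1)]
  simp [sub_eq_neg_add]

/-- The signed type B Eulerian polynomial. -/
lemma sum_sgnB_mul_X_pow_desB (n : ℕ) :
    ∑ p : BPerm n, ((sgnB p : ℤ) : PowerSeries ℚ) * X ^ desB p = (1 - X) ^ n := by
  have key : ∀ u : Equiv.Perm (Fin n),
      ∑ J : Fin n → Bool, ((sgnB (u, J) : ℤ) : PowerSeries ℚ) * X ^ desB (u, J) =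
        ((Equiv.Perm.sign u : ℤ) : PowerSeries ℚ) *
          ∑ J : Fin n → Bool, (-1 : PowerSeries ℚ) ^ #{i | J i = true} * X ^ desB (u, J) :=
    fun u => by
      rw [mul_sum]
      refine sum_congr rfl fun J _ => ?_
      simp [sgnB, mul_assoc]
  rw [Fintype.sum_prod_type]
  simp_rw [key]
  rw [sum_eq_single 1]
  · rw [sum_neg_one_pow_mul_X_pow_desB_one]
    simp
  · intro u _ hu
    rw [sum_neg_one_pow_mul_X_pow_desB_of_ne_one hu, mul_zero]
  · simp

lemma sgnB_eq_one_or_neg_one (p : BPerm n) : sgnB p = 1 ∨ sgnB p = -1 := by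
  rcases Int.units_eq_one_or (Equiv.Perm.sign p.1) with h | h <;>
    rcases neg_one_pow_eq_or ℤ #{i | p.2 i = true} with h' | h' <;>
      simp [sgnB, h, h']

end SignedPermutations

theorem typeB_negative_eulerian_series (n : ℕ) (hn : 1 ≤ n) :
    ∑ p ∈ Finset.univ.filter (fun p : BPerm n => sgnB p = -1),
        (PowerSeries.X : PowerSeries ℚ) ^ (desB p)
      = (1 - PowerSeries.X) ^ (n + 1) *
          PowerSeries.mk (fun k => ((2 * (k : ℚ) + 1) ^ n - 1) / 2) := by
  have hterm : ∀ p : BPerm n, (if sgnB p = -1 then (X : PowerSeries ℚ) ^ desB p else 0) =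
      C (1 / 2 : ℚ) * (X ^ desB p - ((sgnB p : ℤ) : PowerSeries ℚ) * X ^ desB p) := fun p => by
    have hC : C (1 / 2 : ℚ) * 2 = 1 := by
      rw [← map_ofNat (C (R := ℚ)) 2, ← map_mul]
      norm_num
    rcases sgnB_eq_one_or_neg_one p with h | h
    · simp [h]
    · rw [if_pos h, h]
      push_cast
      linear_combination (-(X : PowerSeries ℚ) ^ desB p) * hC
  have hmk : PowerSeries.mk (fun k => ((2 * (k : ℚ) + 1) ^ n - 1) / 2) =
      C (1 / 2 : ℚ) *
        (PowerSeries.mk (fun k => (2 * (k : ℚ) + 1) ^ n) - PowerSeries.mk fun _ => 1) := by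
    ext k
    simp only [coeff_mk, coeff_C_mul, map_sub]
    ring
  rw [sum_filter, sum_congr rfl fun p _ => hterm p, ← mul_sum, sum_sub_distrib, sum_X_pow_desB,
    sum_sgnB_mul_X_pow_desB, hmk]
  linear_combination (-C (1 / 2 : ℚ) * (1 - X) ^ n) * (-one_sub_X_mul_mk_one)
end
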